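/- Rudin–Keisler antisymmetry up to isomorphism: if U and V are ultrafilters on a set X with U ≤_RK V and V ≤_RK U, then there exists a bijection f : X → X with f_*(V) = U. -/

import Mathlib

open Filter in
theorem rk_no_color {X : Type*} {V : Ultrafilter X} {f : X → X} (h : Ultrafilter.map f V = V)
    (c : X → Prop) (hc : ∀ᶠ x in (V : Filter X), ¬ (c (f x) ↔ c x)) : False := by
  have key : ∀ s : Set X, s ∈ V ↔ f ⁻¹' s ∈ V := fun s => by
    rw [← Ultrafilter.mem_map, h]
  rcases V.em c with h1 | h1
  · have h2 : ∀ᶠ x in (V : Filter X), c (f x) := (key {x | c x}).1 h1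
    obtain ⟨x, a, b, d⟩ := (h1.and (h2.and hc)).exists
    tauto
  · have h2 : ∀ᶠ x in (V : Filter X), ¬ c (f x) := (key {x | ¬ c x}).1 h1
    obtain ⟨x, a, b, d⟩ := (h1.and (h2.and hc)).exists
    tauto

open Filter in
theorem rk_no_exit {X : Type*} {V : Ultrafilter X} {f : X → X} (h : Ultrafilter.map f V = V)
    (P : X → Prop) (hP : ∀ᶠ x in (V : Filter X), P x ∧ ∃ n, ¬ P (f^[n] x)) : False := by
  classical
  let c : X → Prop := fun x => if hx : ∃ n, ¬ P (f^[n] x) then Even (Nat.find hx) else True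
  refine rk_no_color h c (hP.mono ?_)
  rintro x ⟨hx, hn⟩
  have h0 : Nat.find hn ≠ 0 := by
    intro h0
    have := Nat.find_spec hn
    rw [h0] at this
    exact this hx
  obtain ⟨k, hk⟩ := Nat.exists_eq_succ_of_ne_zero h0
  have hs := Nat.find_spec hn
  rw [hk, Function.iterate_succ_apply] at hs
  have hn' : ∃ n, ¬ P (f^[n] (f x)) := ⟨k, hs⟩
  have hk' : Nat.find hn' = k := by
    rw [Nat.find_eq_iff]
    refine ⟨hs, fun m hm => ?_⟩
    have := Nat.find_min hn (m := m + 1) (by omega)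
    rwa [Function.iterate_succ_apply] at this
  simp only [c, dif_pos hn, dif_pos hn', hk, hk', Nat.succ_eq_add_one]
  grind

open Filter in
theorem rk_no_inj {X : Type*} {V : Ultrafilter X} {f : X → X} (h : Ultrafilter.map f V = V)
    (hP : ∀ᶠ x in (V : Filter X), Function.Injective (fun n => f^[n] x)) : False := by
  classical
  let s : Setoid X :=
    { r := fun x y => ∃ m n, f^[m] x = f^[n] y
      iseqv := ⟨fun x => ⟨0, 0, rfl⟩, fun ⟨m, n, e⟩ => ⟨n, m, e.symm⟩, by
        rintro x y z ⟨m, n, e⟩ ⟨p, q, e'⟩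
        refine ⟨p + m, n + q, ?_⟩
        rw [Function.iterate_add_apply, e, Function.iterate_add_apply, ← e',
          ← Function.iterate_add_apply, ← Function.iterate_add_apply, add_comm]⟩ }
  let r : X → X := fun x => (Quotient.mk s x).out
  have hr : ∀ x, ∃ m n, f^[m] x = f^[n] (r x) := fun x => s.symm (Quotient.mk_out (s := s) x)
  have hrf : ∀ x, r (f x) = r x := fun x => by
    have : Quotient.mk s (f x) = Quotient.mk s x := Quotient.sound ⟨0, 1, rfl⟩
    simp only [r, this]
  choose m n hmn using hr
  refine rk_no_color h (fun x => Even (m x + n x)) (hP.mono ?_)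
  intro x hx
  have e1 := hmn x
  have e2 := hmn (f x)
  rw [hrf, ← Function.iterate_succ_apply] at e2
  have : n (f x) + m x = n x + (m (f x)).succ := by
    apply hx
    simp only
    rw [Function.iterate_add_apply, e1, Function.iterate_add_apply, e2,
      ← Function.iterate_add_apply, ← Function.iterate_add_apply, add_comm]
  grind

open Filter in
theorem rk_fixed {X : Type*} {V : Ultrafilter X} {f : X → X} (h : Ultrafilter.map f V = V) :
    ∀ᶠ x in (V : Filter X), f x = x := by
  classical
  obtain ⟨lo, wo⟩ := exists_wellOrder X
  rcases V.em (fun x => f x = x) with h1 | h1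
  · exact h1
  exfalso
  rcases V.em (fun x => Function.Injective (fun n => f^[n] x)) with h2 | h2
  · exact rk_no_inj h h2
  rcases V.em (fun x => f x < x) with h3 | h3
  · refine rk_no_exit h (fun x => f x < x) (h3.mono fun x hx => ⟨hx, ?_⟩)
    by_contra! hc
    refine (RelEmbedding.natGT (r := (· < ·)) (fun n => f^[n] x) ?_).not_wellFounded wo.wf
    intro n
    simpa [Function.iterate_succ_apply'] using hc n
  · refine rk_no_exit h (fun x => x < f x) ?_
    filter_upwards [h1, h2, h3] with x h1 h2 h3
    refine ⟨lt_of_le_of_ne (not_lt.1 h3) (Ne.symm h1), ?_⟩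
    by_contra! hc
    refine h2 (strictMono_nat_of_lt_succ fun n => ?_).injective
    simpa [Function.iterate_succ_apply'] using hc n

open Cardinal in
theorem rk_compl_card {X : Type*} {S T : Set X} (hS : S.Infinite) (hd : Disjoint S T)
    (hc : #S = #T) : #(Sᶜ : Set X) = #X := by
  have h1 : #S ≤ #(Sᶜ : Set X) := hc ▸ mk_le_mk_of_subset hd.subset_compl_left
  have h2 : ℵ₀ ≤ #S := by
    have := hS.to_subtype
    exact aleph0_le_mk _
  rw [← mk_sum_compl S, add_eq_right (h2.trans h1) h1]

open Cardinal in
theorem rk_extend {X : Type*} {S T : Set X} {g : X → X} (hS : S.Infinite) (hd : Disjoint S T)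
    (hc : #S = #T) (hg : Set.InjOn g (S ∪ T)) :
    ∃ f : X → X, Function.Bijective f ∧ Set.EqOn f g S := by
  classical
  have hgS := hg.mono Set.subset_union_left
  have hgT := hg.mono Set.subset_union_right
  have hd' : Disjoint (g '' S) (g '' T) := by
    rw [Set.disjoint_left] at hd ⊢
    rintro _ ⟨a, ha, rfl⟩ ⟨b, hb, e⟩
    have := hg (Or.inr hb) (Or.inl ha) e
    exact hd ha (this ▸ hb)
  have h1 := rk_compl_card hS hd hc
  have h2 := rk_compl_card (hS.image hgS) hd'
    (by rw [mk_image_eq_of_injOn _ _ hgS, mk_image_eq_of_injOn _ _ hgT, hc])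
  obtain ⟨e⟩ := Cardinal.eq.1 (h1.trans h2.symm)
  let e0 := hgS.bijOn_image.equiv
  let E : X ≃ X := (Equiv.Set.sumCompl S).symm.trans
    ((Equiv.sumCongr e0 e).trans (Equiv.Set.sumCompl (g '' S)))
  refine ⟨E, E.bijective, fun x hx => ?_⟩
  simp only [E, Equiv.trans_apply, Equiv.Set.sumCompl_symm_apply_of_mem hx]
  rfl

/-- Rudin–Keisler antisymmetry up to isomorphism: mutually RK-below ultrafilters on the
same set are isomorphic via a bijection. -/
theorem rudinKeisler_antisymm {X : Type*} (U V : Ultrafilter X)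
    (h₁ : ∃ π : X → X, Ultrafilter.map π V = U)
    (h₂ : ∃ σ : X → X, Ultrafilter.map σ U = V) :
    ∃ f : X → X, Function.Bijective f ∧ Ultrafilter.map f V = U := by
  classical
  obtain ⟨p, hp⟩ := h₁
  obtain ⟨q, hq⟩ := h₂
  have hfix : Ultrafilter.map (q ∘ p) V = V := by
    rw [← Ultrafilter.map_map, hp, hq]
  have hS : {x | (q ∘ p) x = x} ∈ V := rk_fixed hfix
  set S := {x | (q ∘ p) x = x} with hSdef
  have hinj : Set.InjOn p S := by
    intro a ha b hb e
    have ha' : q (p a) = a := ha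
    have hb' : q (p b) = b := hb
    rw [← ha', e, hb']
  by_cases hfin : S.Finite
  · obtain ⟨a, -, rfl⟩ := Ultrafilter.eq_pure_of_finite_mem hfin hS
    refine ⟨Equiv.swap a (p a), Equiv.bijective _, ?_⟩
    rw [← hp, Ultrafilter.map_pure, Ultrafilter.map_pure, Equiv.swap_apply_left]
  have hinf : Infinite S := Set.infinite_coe_iff.2 hfin
  have hcard : Cardinal.mk (S ⊕ S) = Cardinal.mk S := by
    rw [Cardinal.mk_sum, Cardinal.lift_id, Cardinal.add_eq_self (Cardinal.aleph0_le_mk _)]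
  obtain ⟨e⟩ := Cardinal.eq.1 hcard
  let i : S → X := fun x => e (Sum.inl x)
  let j : S → X := fun x => e (Sum.inr x)
  have hi : Function.Injective i := fun a b h => Sum.inl_injective (e.injective (Subtype.ext h))
  have hj : Function.Injective j := fun a b h => Sum.inr_injective (e.injective (Subtype.ext h))
  have hd : Disjoint (Set.range i) (Set.range j) := by
    rw [Set.disjoint_left]
    rintro _ ⟨a, rfl⟩ ⟨b, h⟩
    exact Sum.inr_ne_inl (e.injective (Subtype.ext h))
  have hu : Set.range i ∪ Set.range j = S := by
    ext x
    constructor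
    · rintro (⟨a, rfl⟩ | ⟨a, rfl⟩) <;> exact Subtype.prop _
    · intro hx
      obtain ⟨y, hy⟩ := e.surjective ⟨x, hx⟩
      rcases y with y | y
      · exact Or.inl ⟨y, congrArg Subtype.val hy⟩
      · exact Or.inr ⟨y, congrArg Subtype.val hy⟩
  have hc : Cardinal.mk (Set.range i) = Cardinal.mk (Set.range j) := by
    rw [Cardinal.mk_range_eq _ hi, Cardinal.mk_range_eq _ hj]
  have fin : ∀ A B : Set X, A.Infinite → Disjoint A B → Cardinal.mk A = Cardinal.mk B →
      A ∪ B = S → A ∈ V → ∃ f : X → X, Function.Bijective f ∧ Ultrafilter.map f V = U := by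
    intro A B hA hAB hcAB hABS hAV
    obtain ⟨f, hf, hfe⟩ := rk_extend hA hAB hcAB (hABS ▸ hinj)
    refine ⟨f, hf, ?_⟩
    rw [← hp]
    apply Ultrafilter.coe_injective
    rw [Ultrafilter.coe_map, Ultrafilter.coe_map]
    exact Filter.map_congr (Filter.mem_of_superset hAV hfe)
  have hV := hS
  rw [← hu, Ultrafilter.union_mem_iff] at hV
  rcases hV with hV | hV
  · exact fin _ _ (Set.infinite_range_of_injective hi) hd hc hu hV
  · exact fin _ _ (Set.infinite_range_of_injective hj) hd.symm hc.symm
      ((Set.union_comm _ _).trans hu) hV
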